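/- Suppose b = 0 and p = 2, so the system reads u_t + a((u² + v²)u)_x + c u_{xxx} = 0, v_t + a((u² + v²)v)_x + c v_{xxx} = 0. If (u, v) is a smooth solution, then for every real ε the rotated pair ũ = u cos ε + v sin ε, ṽ = v cos ε − u sin ε is also a solution. (This is the one-parameter group generated by the symmetry Y₄ = v ∂_u − u ∂_v.) -/

import Mathlib

/-- Partial derivative with respect to the first variable (time `t`). -/
noncomputable def pderivT (u : ℝ × ℝ → ℝ) : ℝ × ℝ → ℝ :=
  fun q => deriv (fun s => u (s, q.2)) q.1

/-- Partial derivative with respect to the second variable (space `x`). -/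
noncomputable def pderivX (u : ℝ × ℝ → ℝ) : ℝ × ℝ → ℝ :=
  fun q => deriv (fun y => u (q.1, y)) q.2

/-- `(u, v)` is a smooth solution of the Gardner-type system
`u_t + a((u^p + v^p)u)_x + b((uv)^p v)_x + c u_{xxx} = 0`,
`v_t + a((u^p + v^p)v)_x + b((uv)^p u)_x + c v_{xxx} = 0`. -/
def IsGardnerSolution (a b c : ℝ) (p : ℕ) (u v : ℝ × ℝ → ℝ) : Prop :=
  ContDiff ℝ (⊤ : ℕ∞) u ∧ ContDiff ℝ (⊤ : ℕ∞) v ∧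
  (∀ q : ℝ × ℝ,
    pderivT u q
      + pderivX (fun q => a * ((u q) ^ p + (v q) ^ p) * u q
          + b * (u q * v q) ^ p * v q) q
      + c * pderivX (pderivX (pderivX u)) q = 0) ∧
  (∀ q : ℝ × ℝ,
    pderivT v q
      + pderivX (fun q => a * ((u q) ^ p + (v q) ^ p) * v q
          + b * (u q * v q) ^ p * u q) q
      + c * pderivX (pderivX (pderivX v)) q = 0)

theorem pderivX_contDiff {f : ℝ × ℝ → ℝ} (hf : ContDiff ℝ (⊤ : ℕ∞) f) :
    ContDiff ℝ (⊤ : ℕ∞) (pderivX f) := by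
  have h : pderivX f = fun q => fderiv ℝ f q (0, 1) := by
    funext q
    have h1 : HasDerivAt (fun y : ℝ => (q.1, y)) ((0 : ℝ), (1 : ℝ)) q.2 :=
      (hasDerivAt_const q.2 q.1).prodMk (hasDerivAt_id q.2)
    have h2 : HasFDerivAt f (fderiv ℝ f q) (q.1, q.2) :=
      (hf.differentiable (by simp) q).hasFDerivAt
    exact (h2.comp_hasDerivAt q.2 h1).deriv
  rw [h]
  exact (hf.fderiv_right (m := ((⊤ : ℕ∞) : WithTop ℕ∞)) (by simp)).clm_apply contDiff_const

theorem pderivX_lin {f g : ℝ × ℝ → ℝ} (hf : ContDiff ℝ (⊤ : ℕ∞) f)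
    (hg : ContDiff ℝ (⊤ : ℕ∞) g) (r s : ℝ) :
    pderivX (fun q => f q * r + g q * s) = fun q => pderivX f q * r + pderivX g q * s := by
  funext q
  have h1 : Differentiable ℝ f := hf.differentiable (by simp)
  have h2 : Differentiable ℝ g := hg.differentiable (by simp)
  have h3 : DifferentiableAt ℝ (fun y => f (q.1, y)) q.2 := by fun_prop
  have h4 : DifferentiableAt ℝ (fun y => g (q.1, y)) q.2 := by fun_prop
  exact ((h3.hasDerivAt.mul_const r).add (h4.hasDerivAt.mul_const s)).deriv

theorem pderivT_lin {f g : ℝ × ℝ → ℝ} (hf : ContDiff ℝ (⊤ : ℕ∞) f)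
    (hg : ContDiff ℝ (⊤ : ℕ∞) g) (r s : ℝ) :
    pderivT (fun q => f q * r + g q * s) = fun q => pderivT f q * r + pderivT g q * s := by
  funext q
  have h1 : Differentiable ℝ f := hf.differentiable (by simp)
  have h2 : Differentiable ℝ g := hg.differentiable (by simp)
  have h3 : DifferentiableAt ℝ (fun t => f (t, q.2)) q.1 := by fun_prop
  have h4 : DifferentiableAt ℝ (fun t => g (t, q.2)) q.1 := by fun_prop
  exact ((h3.hasDerivAt.mul_const r).add (h4.hasDerivAt.mul_const s)).deriv

/-- Rotation symmetry `Y₄ = v ∂_u - u ∂_v` for `b = 0`, `p = 2`: if `(u, v)` solves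
the system, so does `(u cos ε + v sin ε, v cos ε - u sin ε)`. -/
theorem stmt_6 (a b c : ℝ) (p : ℕ) (hb : b = 0) (hp : p = 2) (u v : ℝ × ℝ → ℝ)
    (huv : IsGardnerSolution a b c p u v) (ε : ℝ) :
    IsGardnerSolution a b c p
      (fun q => u q * Real.cos ε + v q * Real.sin ε)
      (fun q => v q * Real.cos ε - u q * Real.sin ε) := by
  subst hb hp
  obtain ⟨hu, hv, h1, h2⟩ := huv
  have hcs := Real.sin_sq_add_cos_sq ε
  have hA : ContDiff ℝ (⊤ : ℕ∞) (fun q => a * ((u q) ^ 2 + (v q) ^ 2) * u q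
          + 0 * (u q * v q) ^ 2 * v q) := by fun_prop
  have hB : ContDiff ℝ (⊤ : ℕ∞) (fun q => a * ((u q) ^ 2 + (v q) ^ 2) * v q
          + 0 * (u q * v q) ^ 2 * u q) := by fun_prop
  have hux := pderivX_contDiff hu
  have hvx := pderivX_contDiff hv
  have huxx := pderivX_contDiff hux
  have hvxx := pderivX_contDiff hvx
  generalize Real.cos ε = r at *
  generalize Real.sin ε = s at *
  have e : (fun q => v q * r - u q * s) = fun q => u q * (-s) + v q * r := by
    funext q; ring
  refine ⟨by fun_prop, by fun_prop, fun q => ?_, fun q => ?_⟩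
  · have e2 : (fun q => a * ((u q * r + v q * s) ^ 2 + (v q * r - u q * s) ^ 2)
          * (u q * r + v q * s)
          + 0 * ((u q * r + v q * s) * (v q * r - u q * s)) ^ 2 * (v q * r - u q * s))
        = fun q => (a * ((u q) ^ 2 + (v q) ^ 2) * u q + 0 * (u q * v q) ^ 2 * v q) * r
          + (a * ((u q) ^ 2 + (v q) ^ 2) * v q + 0 * (u q * v q) ^ 2 * u q) * s := by
      funext q
      linear_combination (a * ((u q) ^ 2 + (v q) ^ 2) * (u q * r + v q * s)) * hcs
    rw [e2, pderivX_lin hA hB, pderivT_lin hu hv, pderivX_lin hu hv, pderivX_lin hux hvx,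
      pderivX_lin huxx hvxx]
    linear_combination r * h1 q + s * h2 q
  · have e2 : (fun q => a * ((u q * r + v q * s) ^ 2 + (v q * r - u q * s) ^ 2)
          * (v q * r - u q * s)
          + 0 * ((u q * r + v q * s) * (v q * r - u q * s)) ^ 2 * (u q * r + v q * s))
        = fun q => (a * ((u q) ^ 2 + (v q) ^ 2) * u q + 0 * (u q * v q) ^ 2 * v q) * (-s)
          + (a * ((u q) ^ 2 + (v q) ^ 2) * v q + 0 * (u q * v q) ^ 2 * u q) * r := by
      funext q
      linear_combination (a * ((u q) ^ 2 + (v q) ^ 2) * (v q * r - u q * s)) * hcs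
    rw [e2, e, pderivX_lin hA hB, pderivT_lin hu hv, pderivX_lin hu hv, pderivX_lin hux hvx,
      pderivX_lin huxx hvxx]
    linear_combination (-s) * h1 q + r * h2 q
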